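/- Let u = √3/2 and let A(31,3) be the arrangement of 31 lines in ℙ²(ℝ) consisting of the ten lines x = 0, x = ∓uz, x = ∓2uz, x = ∓4uz, y = 0, y = ∓z, their images under the rotations by 60° and 120° about (0:0:1), and the line z = 0. Then the set of points of ℙ²(ℝ) lying on at least two of these lines has exactly 127 elements, and for each i the number tᵢ of points lying on exactly i of the 31 lines is: t₂ = 54, t₃ = 42, t₄ = 21, t₅ = 6, t₆ = 1, t₈ = 3, and tᵢ = 0 for all other i ≥ 2. -/

import Mathlib

open MvPolynomial

noncomputable section

/-- The polynomial ring `ℝ[x,y,z]`, with `x = X 0`, `y = X 1`, `z = X 2`. -/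
abbrev PolyR := MvPolynomial (Fin 3) ℝ

/-- `u = √3 / 2`. -/
def u : ℝ := Real.sqrt 3 / 2

/-- The rotation by 60° about `(0:0:1)`. -/
def rotA : Matrix (Fin 3) (Fin 3) ℝ := !![1/2, -u, 0; u, 1/2, 0; 0, 0, 1]

/-- Linear substitution of variables by a matrix `M`:  `(substMat M f)(v) = f(M v)`. -/
def substMat (M : Matrix (Fin 3) (Fin 3) ℝ) : PolyR →ₐ[ℝ] PolyR :=
  MvPolynomial.aeval fun i => ∑ j, MvPolynomial.C (M i j) * MvPolynomial.X j

/-- The ten initial linear forms of the arrangement `A(31,3)`: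
`x`, `x ∓ uz`, `x ∓ 2uz`, `x ∓ 4uz`, `y`, `y ∓ z`. -/
def baseForms313 : Fin 10 → PolyR :=
  ![X 0, X 0 - C u * X 2, X 0 + C u * X 2, X 0 - C (2*u) * X 2, X 0 + C (2*u) * X 2,
    X 0 - C (4*u) * X 2, X 0 + C (4*u) * X 2, X 1, X 1 - X 2, X 1 + X 2]

/-- The 31 linear forms defining the simplicial arrangement `A(31,3)`: the ten initial
forms, their images under the rotations by 60° and 120° about `(0:0:1)` (the image of a
line `{ℓ = 0}` under a matrix `M` being `{ℓ ∘ M⁻¹ = 0}`), and the line at infinity `z = 0`. -/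
def lines313 : Fin 31 → PolyR := fun i =>
  if h : (i : ℕ) < 10 then baseForms313 ⟨i, h⟩
  else if h2 : (i : ℕ) < 20 then substMat rotA⁻¹ (baseForms313 ⟨(i : ℕ) - 10, by omega⟩)
  else if h3 : (i : ℕ) < 30 then substMat (rotA ^ 2)⁻¹ (baseForms313 ⟨(i : ℕ) - 20, by omega⟩)
  else X 2

/-- The real projective plane `ℙ²(ℝ)`. -/
abbrev P2R := Projectivization ℝ (Fin 3 → ℝ)

open Classical in
/-- The number of lines of `A(31,3)` passing through a point `P ∈ ℙ²(ℝ)`. -/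
def mult313 (P : P2R) : ℕ :=
  (Finset.univ.filter fun i => MvPolynomial.eval (Projectivization.rep P) (lines313 i) = 0).card

/-- The set of intersection points of `A(31,3)`: points lying on at least two lines. -/
def S313 : Set P2R := {P | 2 ≤ mult313 P}

end


def LL : List (ℤ × ℤ × ℤ) :=
  [(1,0,0), (1,0,-1), (1,0,1), (1,0,-2), (1,0,2), (1,0,-4), (1,0,4), (0,1,0), (0,1,-1),
  (0,1,1), (1,2,0), (1,2,-2), (1,2,2), (1,2,-4), (1,2,4), (1,2,-8), (1,2,8), (-3,2,0),
  (-3,2,-4), (-3,2,4), (-1,2,0), (-1,2,-2), (-1,2,2), (-1,2,-4), (-1,2,4), (-1,2,-8),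
  (-1,2,8), (-3,-2,0), (-3,-2,-4), (-3,-2,4), (0,0,1)]

def PP : List (ℤ × ℤ × ℤ) :=
  [(-10,-3,2), (-10,-1,1), (-10,1,1), (-10,3,2), (-8,0,1), (-6,-7,1), (-6,-5,2), (-6,-1,1),
  (-6,-1,2), (-6,-1,4), (-6,1,1), (-6,1,2), (-6,1,4), (-6,5,2), (-6,7,1), (-4,-8,1),
  (-4,-6,1), (-4,-4,1), (-4,-3,1), (-4,-2,1), (-4,-1,1), (-4,0,1), (-4,0,3), (-4,1,1),
  (-4,2,1), (-4,3,1), (-4,4,1), (-4,6,1), (-4,8,1), (-2,-9,2), (-2,-7,2), (-2,-5,1),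
  (-2,-5,2), (-2,-5,4), (-2,-3,1), (-2,-3,2), (-2,-3,3), (-2,-3,4), (-2,-2,1), (-2,-1,1),
  (-2,-1,2), (-2,0,1), (-2,1,0), (-2,1,1), (-2,1,2), (-2,2,1), (-2,3,0), (-2,3,1), (-2,3,2),
  (-2,3,3), (-2,3,4), (-2,5,1), (-2,5,2), (-2,5,4), (-2,7,2), (-2,9,2), (-1,-1,1), (-1,0,1),
  (-1,1,1), (0,-4,1), (0,-2,1), (0,-1,1), (0,0,1), (0,1,0), (0,1,1), (0,2,1), (0,4,1),
  (1,-1,1), (1,0,0), (1,0,1), (1,1,1), (2,-9,2), (2,-7,2), (2,-5,1), (2,-5,2), (2,-5,4),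
  (2,-3,1), (2,-3,2), (2,-3,3), (2,-3,4), (2,-2,1), (2,-1,1), (2,-1,2), (2,0,1), (2,1,0),
  (2,1,1), (2,1,2), (2,2,1), (2,3,0), (2,3,1), (2,3,2), (2,3,3), (2,3,4), (2,5,1), (2,5,2),
  (2,5,4), (2,7,2), (2,9,2), (4,-8,1), (4,-6,1), (4,-4,1), (4,-3,1), (4,-2,1), (4,-1,1),
  (4,0,1), (4,0,3), (4,1,1), (4,2,1), (4,3,1), (4,4,1), (4,6,1), (4,8,1), (6,-7,1), (6,-5,2),
  (6,-1,1), (6,-1,2), (6,-1,4), (6,1,1), (6,1,2), (6,1,4), (6,5,2), (6,7,1), (8,0,1),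
  (10,-3,2), (10,-1,1), (10,1,1), (10,3,2)]

theorem LL_len : LL.length = 31 := by decide +kernel
theorem PP_len : PP.length = 127 := by decide +kernel

def L (i : Fin 31) : ℤ × ℤ × ℤ := LL.get (i.cast LL_len.symm)
def Q (k : Fin 127) : ℤ × ℤ × ℤ := PP.get (k.cast PP_len.symm)

def dotI (l p : ℤ × ℤ × ℤ) : ℤ := l.1 * p.1 + l.2.1 * p.2.1 + l.2.2 * p.2.2

def crossI (a b : ℤ × ℤ × ℤ) : ℤ × ℤ × ℤ :=
  (a.2.1 * b.2.2 - a.2.2 * b.2.1, a.2.2 * b.1 - a.1 * b.2.2, a.1 * b.2.1 - a.2.1 * b.1)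

def mI (k : Fin 127) : ℕ := (Finset.univ.filter fun i => dotI (L i) (Q k) = 0).card

theorem Q_ne : ∀ k, Q k ≠ 0 := by decide +kernel
theorem L_pair : LL.Pairwise (fun a b => crossI a b ≠ 0 ∧
    ∃ p ∈ PP, crossI (crossI a b) p = 0) := by decide +kernel
theorem P_pair : PP.Pairwise (fun a b => crossI a b ≠ 0) := by decide +kernel
theorem L_cross (i j : Fin 31) (h : i < j) : crossI (L i) (L j) ≠ 0 :=
  (List.pairwise_iff_get.1 L_pair (i.cast LL_len.symm) (j.cast LL_len.symm) h).1
theorem Q_cover (i j : Fin 31) (h : i < j) :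
    ∃ k, crossI (crossI (L i) (L j)) (Q k) = 0 := by
  obtain ⟨p, hp, hc⟩ :=
    (List.pairwise_iff_get.1 L_pair (i.cast LL_len.symm) (j.cast LL_len.symm) h).2
  obtain ⟨k, rfl⟩ := List.mem_iff_get.1 hp
  exact ⟨k.cast PP_len, hc⟩
theorem Q_inj (i j : Fin 127) (h : i < j) : crossI (Q i) (Q j) ≠ 0 :=
  List.pairwise_iff_get.1 P_pair (i.cast PP_len.symm) (j.cast PP_len.symm) h

/-- the list of multiplicities -/
def MM : List ℕ :=
  [2, 2, 2, 2, 3, 2, 3, 3, 2, 2, 3, 2, 2, 3, 2, 2, 3, 3, 2, 3, 3, 4, 3, 3, 3, 2, 3, 3, 2, 2,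
  3, 3, 2, 2, 4, 4, 3, 2, 2, 5, 4, 4, 8, 5, 4, 2, 4, 4, 4, 3, 2, 3, 2, 2, 3, 2, 2, 2, 2, 3,
  5, 4, 6, 8, 4, 5, 3, 2, 4, 2, 2, 2, 3, 3, 2, 2, 4, 4, 3, 2, 2, 5, 4, 4, 8, 5, 4, 2, 4, 4,
  4, 3, 2, 3, 2, 2, 3, 2, 2, 3, 3, 2, 3, 3, 4, 3, 3, 3, 2, 3, 3, 2, 2, 3, 3, 2, 2, 3, 2, 2,
  3, 2, 3, 2, 2, 2, 2]

theorem MM_len : MM.length = 127 := by decide +kernel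
def mT (k : Fin 127) : ℕ := MM.get (k.cast MM_len.symm)
theorem mI_eq : ∀ k, mI k = mT k := by decide +kernel
theorem mT_mem : ∀ k, mT k = 2 ∨ mT k = 3 ∨ mT k = 4 ∨ mT k = 5 ∨ mT k = 6 ∨ mT k = 8 := by
  decide +kernel
theorem mI_mem (k : Fin 127) :
    mI k = 2 ∨ mI k = 3 ∨ mI k = 4 ∨ mI k = 5 ∨ mI k = 6 ∨ mI k = 8 := by
  rw [mI_eq]; exact mT_mem k
theorem mI_ge (k : Fin 127) : 2 ≤ mI k := by
  have := mI_mem k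
  omega
theorem c2 : (Finset.univ.filter fun k => mI k = 2).card = 54 := by
  simp only [mI_eq]; decide +kernel
theorem c3 : (Finset.univ.filter fun k => mI k = 3).card = 42 := by
  simp only [mI_eq]; decide +kernel
theorem c4 : (Finset.univ.filter fun k => mI k = 4).card = 21 := by
  simp only [mI_eq]; decide +kernel
theorem c5 : (Finset.univ.filter fun k => mI k = 5).card = 6 := by
  simp only [mI_eq]; decide +kernel
theorem c6 : (Finset.univ.filter fun k => mI k = 6).card = 1 := by
  simp only [mI_eq]; decide +kernel
theorem c8 : (Finset.univ.filter fun k => mI k = 8).card = 3 := by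
  simp only [mI_eq]; decide +kernel

theorem u_pos : 0 < u := by unfold u; positivity
theorem u_sq : u * u = 3 / 4 := by
  unfold u
  have := Real.mul_self_sqrt (show (0:ℝ) ≤ 3 by norm_num)
  linarith

theorem rot_inv : rotA⁻¹ = !![1/2, u, 0; -u, 1/2, 0; 0, 0, 1] := by
  apply Matrix.inv_eq_right_inv
  have := u_sq
  ext i j
  fin_cases i <;> fin_cases j <;> simp [rotA, Matrix.mul_apply, Fin.sum_univ_three] <;> linarith

theorem rot2_inv : (rotA ^ 2)⁻¹ = !![-1/2, u, 0; -u, -1/2, 0; 0, 0, 1] := by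
  rw [← Matrix.inv_pow', rot_inv, pow_two]
  have := u_sq
  ext i j
  fin_cases i <;> fin_cases j <;> simp [Matrix.mul_apply, Fin.sum_univ_three] <;> linarith

theorem eval_subst (M : Matrix (Fin 3) (Fin 3) ℝ) (f : PolyR) (v : Fin 3 → ℝ) :
    eval v (substMat M f) = eval (M.mulVec v) f := by
  induction f using MvPolynomial.induction_on with
  | C a => simp [substMat]
  | add p q hp hq => simp [hp, hq]
  | mul_X p i hp =>
    rw [map_mul, map_mul, map_mul, hp]
    simp [substMat, Matrix.mulVec, dotProduct]

/-- real dot product with an integer line -/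
def dotR (l : ℤ × ℤ × ℤ) (a b c : ℝ) : ℝ := l.1 * a + l.2.1 * b + l.2.2 * c

theorem eval_line (i : Fin 31) (a b c : ℝ) :
    eval ![u * a, b, c] (lines313 i) = 0 ↔ dotR (L i) a b c = 0 := by
  have hu := u_sq
  have h0 := u_pos
  have key : ∃ m : ℝ, m ≠ 0 ∧ eval ![u * a, b, c] (lines313 i) = m * dotR (L i) a b c := by
    have e1 : rotA⁻¹.mulVec ![u * a, b, c] = ![u * (a / 2 + b), -3/4 * a + b/2, c] := by
      rw [rot_inv]
      ext j
      fin_cases j <;> simp [Matrix.mulVec, dotProduct, Fin.sum_univ_three]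
      · ring
      · linear_combination (-a) * hu
    have e2 : (rotA ^ 2)⁻¹.mulVec ![u * a, b, c] = ![u * (-a / 2 + b), -3/4 * a - b/2, c] := by
      rw [rot2_inv]
      ext j
      fin_cases j <;> simp [Matrix.mulVec, dotProduct, Fin.sum_univ_three]
      · ring
      · linear_combination (-a) * hu
    by_cases h1 : (i : ℕ) < 10
    · by_cases h2 : (i : ℕ) < 7
      · refine ⟨u, h0.ne', ?_⟩
        obtain ⟨i, hi⟩ := i
        simp only at h1 h2
        interval_cases i <;> simp [lines313, baseForms313, L, LL, dotR] <;> ring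
      · refine ⟨1, one_ne_zero, ?_⟩
        obtain ⟨i, hi⟩ := i
        simp only at h1 h2
        interval_cases i <;> simp_all [lines313, baseForms313, L, LL, dotR] <;> ring
    by_cases h3 : (i : ℕ) < 20
    · have : lines313 i = substMat rotA⁻¹ (baseForms313 ⟨(i : ℕ) - 10, by omega⟩) := by
        simp [lines313, h1, h3]
      rw [this, eval_subst, e1]
      by_cases h2 : (i : ℕ) < 17
      · refine ⟨u / 2, by positivity, ?_⟩
        obtain ⟨i, hi⟩ := i
        simp only at h1 h2
        interval_cases i <;> simp_all [baseForms313, L, LL, dotR] <;> ring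
      · refine ⟨1 / 4, by norm_num, ?_⟩
        obtain ⟨i, hi⟩ := i
        simp only at h1 h2
        interval_cases i <;> simp_all [baseForms313, L, LL, dotR] <;> ring
    by_cases h4 : (i : ℕ) < 30
    · have : lines313 i = substMat (rotA ^ 2)⁻¹ (baseForms313 ⟨(i : ℕ) - 20, by omega⟩) := by
        simp [lines313, h1, h3, h4]
      rw [this, eval_subst, e2]
      by_cases h2 : (i : ℕ) < 27
      · refine ⟨u / 2, by positivity, ?_⟩
        obtain ⟨i, hi⟩ := i
        simp only at h1 h2
        interval_cases i <;> simp_all [baseForms313, L, LL, dotR] <;> ring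
      · refine ⟨1 / 4, by norm_num, ?_⟩
        obtain ⟨i, hi⟩ := i
        simp only at h1 h2
        interval_cases i <;> simp_all [baseForms313, L, LL, dotR] <;> ring
    · refine ⟨1, one_ne_zero, ?_⟩
      have : i = ⟨30, by norm_num⟩ := by ext; simp; omega
      subst this
      simp [lines313, L, LL, dotR]
  obtain ⟨m, hm, h⟩ := key
  rw [h]
  simp [hm]

theorem par {n1 n2 n3 w1 w2 w3 : ℝ} (hn : ¬ (n1 = 0 ∧ n2 = 0 ∧ n3 = 0))
    (h1 : n2 * w3 - n3 * w2 = 0) (h2 : n3 * w1 - n1 * w3 = 0) (h3 : n1 * w2 - n2 * w1 = 0) :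
    ∃ c : ℝ, w1 = c * n1 ∧ w2 = c * n2 ∧ w3 = c * n3 := by
  by_cases a1 : n1 = 0
  · by_cases a2 : n2 = 0
    · have a3 : n3 ≠ 0 := fun h => hn ⟨a1, a2, h⟩
      refine ⟨w3 / n3, ?_, ?_, ?_⟩ <;> field_simp <;> linarith
    · refine ⟨w2 / n2, ?_, ?_, ?_⟩ <;> field_simp <;> linarith
  · refine ⟨w1 / n1, ?_, ?_, ?_⟩ <;> field_simp <;> linarith

theorem neR {p : ℤ × ℤ × ℤ} (h : p ≠ 0) :
    ¬ ((p.1 : ℝ) = 0 ∧ (p.2.1 : ℝ) = 0 ∧ (p.2.2 : ℝ) = 0) := by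
  rintro ⟨h1, h2, h3⟩
  apply h
  ext
  · exact_mod_cast h1
  · exact_mod_cast h2
  · exact_mod_cast h3

noncomputable def vec (p : ℤ × ℤ × ℤ) : Fin 3 → ℝ := ![u * (p.1 : ℝ), (p.2.1 : ℝ), (p.2.2 : ℝ)]

theorem vec_ne {p : ℤ × ℤ × ℤ} (h : p ≠ 0) : vec p ≠ 0 := by
  intro hv
  apply neR h
  have h0 := congrFun hv 0
  have h1 := congrFun hv 1
  have h2 := congrFun hv 2
  simp [vec, u_pos.ne'] at h0 h1 h2
  simp [h0, h1, h2]

noncomputable def pt (k : Fin 127) : P2R := Projectivization.mk ℝ (vec (Q k)) (vec_ne (Q_ne k))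

theorem pt_ne {i j : Fin 127} (hij : i < j) : pt i ≠ pt j := by
  intro h
  rw [pt, pt, Projectivization.mk_eq_mk_iff'] at h
  obtain ⟨c, hc⟩ := h
  apply neR (Q_inj i j hij)
  have h0 := congrFun hc 0
  have h1 := congrFun hc 1
  have h2 := congrFun hc 2
  simp only [vec, Pi.smul_apply, smul_eq_mul, Matrix.cons_val] at h0 h1 h2
  have h0' : ((Q i).1 : ℝ) = c * (Q j).1 := by
    apply mul_left_cancel₀ u_pos.ne'
    rw [← h0]; ring
  simp only [crossI]
  push_cast
  rw [h0', ← h1, ← h2]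
  refine ⟨?_, ?_, ?_⟩ <;> ring

theorem pt_inj : Function.Injective pt := by
  intro i j h
  rcases lt_trichotomy i j with h1 | h1 | h1
  · exact absurd h (pt_ne h1)
  · exact h1
  · exact absurd h.symm (pt_ne h1)

theorem mult_pt (k : Fin 127) : mult313 (pt k) = mI k := by
  classical
  unfold mult313 mI
  congr 1
  ext i
  simp only [Finset.mem_filter, Finset.mem_univ, true_and]
  obtain ⟨c, hc⟩ := Projectivization.exists_smul_eq_mk_rep ℝ (vec (Q k)) (vec_ne (Q_ne k))
  have : (pt k).rep = ![u * (c * (Q k).1), c * (Q k).2.1, c * (Q k).2.2] := by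
    rw [pt, ← hc]
    ext j
    fin_cases j <;> simp [vec, Units.smul_def]
    ring
  rw [this, eval_line]
  have e : dotR (L i) (c * (Q k).1) (c * (Q k).2.1) (c * (Q k).2.2)
      = c * ((dotI (L i) (Q k) : ℤ) : ℝ) := by
    simp only [dotR, dotI]; push_cast; ring
  rw [e]
  simp

theorem exists_pt (P : P2R) (h : 2 ≤ mult313 P) : ∃ k, pt k = P := by
  classical
  obtain ⟨i, hi, j, hj, hij⟩ := Finset.one_lt_card.1 h
  simp only [Finset.mem_filter, Finset.mem_univ, true_and] at hi hj
  wlog hlt : i < j generalizing i j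
  · refine this (i := j) (j := i) ?_ ?_ ?_ ?_ <;> first | assumption | exact hij.symm | exact (lt_of_le_of_ne (not_lt.1 hlt) hij.symm)
  have hu := u_pos
  obtain ⟨a, b, c, hv⟩ : ∃ a b c, P.rep = ![u * a, b, c] := by
    refine ⟨P.rep 0 / u, P.rep 1, P.rep 2, ?_⟩
    ext j
    fin_cases j <;> simp
    field_simp
  rw [hv, eval_line] at hi hj
  obtain ⟨k, hk⟩ := Q_cover i j hlt
  refine ⟨k, ?_⟩
  have hn := neR (L_cross i j hlt)
  set n := crossI (L i) (L j) with hndef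
  have n1 : (n.1 : ℝ) = (L i).2.1 * (L j).2.2 - (L i).2.2 * (L j).2.1 := by
    rw [hndef]; simp [crossI]
  have n2 : (n.2.1 : ℝ) = (L i).2.2 * (L j).1 - (L i).1 * (L j).2.2 := by
    rw [hndef]; simp [crossI]
  have n3 : (n.2.2 : ℝ) = (L i).1 * (L j).2.1 - (L i).2.1 * (L j).1 := by
    rw [hndef]; simp [crossI]
  simp only [dotR] at hi hj
  obtain ⟨s, s1, s2, s3⟩ := par (w1 := a) (w2 := b) (w3 := c) hn
    (by rw [n2, n3]; linear_combination (L j).1 * hi - (L i).1 * hj)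
    (by rw [n1, n3]; linear_combination (L j).2.1 * hi - (L i).2.1 * hj)
    (by rw [n1, n2]; linear_combination (L j).2.2 * hi - (L i).2.2 * hj)
  have k1 := congrArg (fun p : ℤ × ℤ × ℤ => (p.1 : ℝ)) hk
  have k2 := congrArg (fun p : ℤ × ℤ × ℤ => (p.2.1 : ℝ)) hk
  have k3 := congrArg (fun p : ℤ × ℤ × ℤ => (p.2.2 : ℝ)) hk
  simp only [crossI, Prod.fst_zero, Prod.snd_zero] at k1 k2 k3
  push_cast at k1 k2 k3
  obtain ⟨t, t1, t2, t3⟩ := par hn k1 k2 k3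
  have hs : s ≠ 0 := by
    rintro rfl
    apply P.rep_nonzero
    rw [hv, s1, s2, s3]
    ext j
    fin_cases j <;> simp
  rw [← P.mk_rep, pt, Projectivization.mk_eq_mk_iff']
  refine ⟨t / s, ?_⟩
  rw [hv, s1, s2, s3, vec, t1, t2, t3]
  ext j
  fin_cases j <;> simp <;> field_simp

theorem fiber (m : ℕ) (hm : 2 ≤ m) :
    {P : P2R | mult313 P = m}.ncard = (Finset.univ.filter fun k => mI k = m).card := by
  have : {P : P2R | mult313 P = m}
      = pt '' ((Finset.univ.filter fun k => mI k = m : Finset (Fin 127)) : Set (Fin 127)) := by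
    ext P
    simp only [Set.mem_ofPred_eq, Set.mem_image, Finset.coe_filter, Finset.mem_univ, true_and]
    constructor
    · intro h
      obtain ⟨k, rfl⟩ := exists_pt P (h ▸ hm)
      exact ⟨k, by rw [← mult_pt, h], rfl⟩
    · rintro ⟨k, hk, rfl⟩
      rw [mult_pt, hk]
  rw [this, Set.ncard_image_of_injective _ pt_inj, Set.ncard_coe_finset]

/-- The arrangement `A(31,3)` has exactly 127 intersection points, with multiplicity
vector `t₂ = 54`, `t₃ = 42`, `t₄ = 21`, `t₅ = 6`, `t₆ = 1`, `t₈ = 3`, and `tᵢ = 0` for all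
other `i ≥ 2`. -/
theorem stmt5 :
    S313.ncard = 127 ∧
    {P : P2R | mult313 P = 2}.ncard = 54 ∧
    {P : P2R | mult313 P = 3}.ncard = 42 ∧
    {P : P2R | mult313 P = 4}.ncard = 21 ∧
    {P : P2R | mult313 P = 5}.ncard = 6 ∧
    {P : P2R | mult313 P = 6}.ncard = 1 ∧
    {P : P2R | mult313 P = 8}.ncard = 3 ∧
    ∀ i : ℕ, 2 ≤ i → i ∉ ({2, 3, 4, 5, 6, 8} : Set ℕ) →
      {P : P2R | mult313 P = i} = ∅ := by
  refine ⟨?_, ?_, ?_, ?_, ?_, ?_, ?_, ?_⟩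
  · have : S313 = pt '' Set.univ := by
      ext P
      simp only [S313, Set.mem_ofPred_eq, Set.image_univ, Set.mem_range]
      constructor
      · exact exists_pt P
      · rintro ⟨k, rfl⟩
        rw [mult_pt]
        exact mI_ge k
    rw [this, Set.ncard_image_of_injective _ pt_inj, Set.ncard_univ, Nat.card_fin]
  · rw [fiber _ (by norm_num), c2]
  · rw [fiber _ (by norm_num), c3]
  · rw [fiber _ (by norm_num), c4]
  · rw [fiber _ (by norm_num), c5]
  · rw [fiber _ (by norm_num), c6]
  · rw [fiber _ (by norm_num), c8]
  · intro i hi hni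
    ext P
    simp only [Set.mem_ofPred_eq, Set.mem_empty_iff_false, iff_false]
    intro h
    obtain ⟨k, rfl⟩ := exists_pt P (h ▸ hi)
    rw [mult_pt] at h
    apply hni
    rw [← h]
    simpa using mI_mem k
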